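/- Let x, x' be adjacent vertices of degrees d, d' on a triangulated surface satisfying the genericity conditions (B) and (G), with 6 ≤ d' and 5 ≤ d ≤ d'. Then the Ollivier–Ricci curvature of the edge (x,x') equals ric(x,x') = 4/d + 8/d' − 2. -/

import Mathlib

open Classical Filter
noncomputable section

/-- A coupling (transference plan) between two measures on `V`, given as
nonnegative density functions. -/
def IsCoupling {V : Type*} (μ ν : V → ℝ) (ξ : V → V → ℝ) : Prop :=
  (∀ y y', 0 ≤ ξ y y') ∧ (∀ y, ∑' y', ξ y y' = μ y) ∧ (∀ y', ∑' y, ξ y y' = ν y')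

/-- The 1-Wasserstein distance between `μ` and `ν` for the cost function `ρ`. -/
def W1 {V : Type*} (ρ : V → V → ℝ) (μ ν : V → ℝ) : ℝ :=
  sInf {c | ∃ ξ, IsCoupling μ ν ξ ∧
    HasSum (fun p : V × V => ξ p.1 p.2 * ρ p.1 p.2) c}

/-- The shortest-path distance of a graph, as a real number. -/
def graphDist {V : Type*} (G : SimpleGraph V) (x y : V) : ℝ := G.dist x y

/-- The degree of a vertex. -/
def deg {V : Type*} (G : SimpleGraph V) (x : V) : ℕ := Nat.card {y | G.Adj x y}

/-- The Dirac measure at `x`. -/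
def dirac {V : Type*} (x : V) : V → ℝ := fun y => if y = x then 1 else 0

/-- The lazy random walk `μ_x^t = (1-t)·δ_x + t·(uniform measure on the neighbors of x)`. -/
def lazyWalk {V : Type*} (G : SimpleGraph V) (t : ℝ) (x y : V) : ℝ :=
  if y = x then 1 - t else if G.Adj x y then t / (deg G x) else 0

/-- The coarse Ricci curvature `κ^t(x,x') = 1 - W₁(μ_x^t, μ_{x'}^t)/d(x,x')`. -/
def kappa {V : Type*} (G : SimpleGraph V) (t : ℝ) (x x' : V) : ℝ :=
  1 - W1 (graphDist G) (lazyWalk G t x) (lazyWalk G t x') / graphDist G x x'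

/-- The (closed) star of a vertex: the vertex together with its neighbors. -/
def starSet {V : Type*} (G : SimpleGraph V) (x : V) : Set V :=
  insert x (G.neighborSet x)

/-- The link of a vertex `v` is a cycle: its neighbors can be indexed cyclically
by `ZMod (deg G v)` so that two neighbors are adjacent iff they are cyclically
consecutive.  This encodes that `v` is an interior vertex of a triangulated
surface (hypothesis (B)). -/
def LinkIsCycle {V : Type*} (G : SimpleGraph V) (v : V) : Prop :=
  ∃ e : ZMod (deg G v) ≃ {y // G.Adj v y},
    ∀ i j : ZMod (deg G v), G.Adj (e i) (e j) ↔ (i ≠ j ∧ (i = j + 1 ∨ j = i + 1))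

/-- Hypothesis (G): for any `y ∈ star(x)` and `y' ∈ star(x')` there is a
geodesic from `y` to `y'` contained in `star(x) ∪ star(x')`. -/
def GeodesicsInStars {V : Type*} (G : SimpleGraph V) (x x' : V) : Prop :=
  ∀ y y', y ∈ starSet G x → y' ∈ starSet G x' →
    ∃ p : G.Walk y y', p.length = G.dist y y' ∧
      ∀ v ∈ p.support, v ∈ starSet G x ∪ starSet G x'


lemma aux_lower {V : Type*} (T : Finset V) (ρ : V → V → ℝ) (μ ν u v : V → ℝ)
    (hρ0 : ∀ y y', 0 ≤ ρ y y') (hρ1 : ∀ y y', y ≠ y' → 1 ≤ ρ y y')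
    (hμ : ∀ y, y ∉ T → μ y = 0) (hν : ∀ y, y ∉ T → ν y = 0)
    (huv : ∀ y y', μ y ≠ 0 → ν y' ≠ 0 → u y - v y' ≤ ρ y y')
    (ξ : V → V → ℝ) (hξ : IsCoupling μ ν ξ) (c : ℝ)
    (hc : HasSum (fun p : V × V => ξ p.1 p.2 * ρ p.1 p.2) c) :
    ∑ y ∈ T, u y * μ y - ∑ y ∈ T, v y * ν y ≤ c := by
  obtain ⟨h0, hr, hcol⟩ := hξ
  have key : ∀ (f g : V → ℝ) (z : V), (∀ y, 0 ≤ f y) → (∀ y, 0 ≤ g y) → (∀ y, y ≠ z → 1 ≤ g y) →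
      Summable (fun y => f y * g y) → Summable f := by
    intro f g z hf hg hg1 hs
    have h2 : Summable (fun y => f y * g y + (if y = z then f z else 0)) :=
      hs.add (summable_of_ne_finset_zero (s := {z}) (by intro b hb; simp at hb; simp [hb]))
    refine Summable.of_nonneg_of_le hf ?_ h2
    intro y
    by_cases hy : y = z
    · subst hy; simp; exact mul_nonneg (hf _) (hg _)
    · simp [hy]; nlinarith [hf y, hg1 y hy]
  have hsr : ∀ y, Summable (ξ y) := fun y =>
    key (ξ y) (ρ y) y (h0 y) (hρ0 y) (fun z hz => hρ1 _ _ hz.symm) (hc.summable.prod_factor y)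
  have hsc : ∀ y', Summable (fun y => ξ y y') := fun y' =>
    key (fun y => ξ y y') (fun y => ρ y y') y' (fun y => h0 y y') (fun y => hρ0 y y')
      (fun z hz => hρ1 _ _ hz)
      (hc.summable.comp_injective (i := fun y => (y, y')) (fun p q h => by simpa using h))
  have hzr : ∀ y y', μ y = 0 → ξ y y' = 0 := by
    intro y y' hy
    have h1 : HasSum (ξ y) 0 := by have := (hsr y).hasSum; rwa [hr, hy] at this
    have := (hasSum_zero_iff_of_nonneg (h0 y)).1 h1
    exact congrFun this y'
  have hzc : ∀ y y', ν y' = 0 → ξ y y' = 0 := by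
    intro y y' hy
    have h1 : HasSum (fun y => ξ y y') 0 := by have := (hsc y').hasSum; rwa [hcol, hy] at this
    have := (hasSum_zero_iff_of_nonneg (f := fun y => ξ y y') (fun y => h0 y y')).1 h1
    exact congrFun this y
  have hrs : ∀ y, ∑ y' ∈ T, ξ y y' = μ y := by
    intro y; rw [← hr y, tsum_eq_sum]; intro b hb; exact hzc _ _ (hν b hb)
  have hcs : ∀ y', ∑ y ∈ T, ξ y y' = ν y' := by
    intro y; rw [← hcol y, tsum_eq_sum]; intro b hb; exact hzr _ _ (hμ b hb)
  have hcc : c = ∑ p ∈ T ×ˢ T, ξ p.1 p.2 * ρ p.1 p.2 := by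
    refine hc.unique (hasSum_sum_of_ne_finset_zero ?_)
    rintro ⟨y, y'⟩ hb
    simp only [Finset.mem_product, not_and_or] at hb
    rcases hb with hb | hb
    · simp [hzr _ _ (hμ _ hb)]
    · simp [hzc _ _ (hν _ hb)]
  rw [hcc, Finset.sum_product]
  have e1 : ∑ y ∈ T, u y * μ y = ∑ y ∈ T, ∑ y' ∈ T, ξ y y' * u y := by
    refine Finset.sum_congr rfl fun y _ => ?_
    rw [← hrs y, ← Finset.sum_mul, mul_comm]
  have e2 : ∑ y ∈ T, v y * ν y = ∑ y ∈ T, ∑ y' ∈ T, ξ y y' * v y' := by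
    rw [Finset.sum_comm]
    refine Finset.sum_congr rfl fun y _ => ?_
    rw [← hcs y, ← Finset.sum_mul, mul_comm]
  rw [e1, e2, ← Finset.sum_sub_distrib]
  refine Finset.sum_le_sum fun y _ => ?_
  rw [← Finset.sum_sub_distrib]
  refine Finset.sum_le_sum fun y' _ => ?_
  rw [← mul_sub]
  by_cases h1 : μ y = 0
  · simp [hzr _ _ h1]
  by_cases h2 : ν y' = 0
  · simp [hzc _ _ h2]
  exact mul_le_mul_of_nonneg_left (huv _ _ h1 h2) (h0 _ _)

lemma aux_upper {V : Type*} (T : Finset V) (ρ : V → V → ℝ) (μ ν u v : V → ℝ)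
    (ξ : V → V → ℝ) (h0 : ∀ y y', 0 ≤ ξ y y')
    (hz1 : ∀ y y', y ∉ T → ξ y y' = 0) (hz2 : ∀ y y', y' ∉ T → ξ y y' = 0)
    (hr : ∀ y, ∑ y' ∈ T, ξ y y' = μ y) (hcol : ∀ y', ∑ y ∈ T, ξ y y' = ν y')
    (ht : ∀ y y', ξ y y' ≠ 0 → ρ y y' ≤ u y - v y') :
    ∃ c ≤ ∑ y ∈ T, u y * μ y - ∑ y ∈ T, v y * ν y, ∃ ξ, IsCoupling μ ν ξ ∧
      HasSum (fun p : V × V => ξ p.1 p.2 * ρ p.1 p.2) c := by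
  refine ⟨∑ p ∈ T ×ˢ T, ξ p.1 p.2 * ρ p.1 p.2, ?_, ξ, ⟨h0, ?_, ?_⟩, ?_⟩
  · have e1 : ∑ y ∈ T, u y * μ y = ∑ y ∈ T, ∑ y' ∈ T, ξ y y' * u y := by
      refine Finset.sum_congr rfl fun y _ => ?_
      rw [← hr y, ← Finset.sum_mul, mul_comm]
    have e2 : ∑ y ∈ T, v y * ν y = ∑ y ∈ T, ∑ y' ∈ T, ξ y y' * v y' := by
      rw [Finset.sum_comm]
      refine Finset.sum_congr rfl fun y _ => ?_
      rw [← hcol y, ← Finset.sum_mul, mul_comm]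
    rw [Finset.sum_product, e1, e2, ← Finset.sum_sub_distrib]
    refine Finset.sum_le_sum fun y _ => ?_
    rw [← Finset.sum_sub_distrib]
    refine Finset.sum_le_sum fun y' _ => ?_
    rw [← mul_sub]
    by_cases h1 : ξ y y' = 0
    · simp [h1]
    exact mul_le_mul_of_nonneg_left (ht _ _ h1) (h0 _ _)
  · intro y; rw [← hr y, tsum_eq_sum]; intro b hb; exact hz2 _ _ hb
  · intro y; rw [← hcol y, tsum_eq_sum]; intro b hb; exact hz1 _ _ hb
  · refine hasSum_sum_of_ne_finset_zero ?_
    rintro ⟨y, y'⟩ hb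
    simp only [Finset.mem_product, not_and_or] at hb
    rcases hb with hb | hb
    · simp [hz1 _ _ hb]
    · simp [hz2 _ _ hb]

lemma aux_W1 {V : Type*} (T : Finset V) (ρ : V → V → ℝ) (μ ν u v : V → ℝ)
    (hρ0 : ∀ y y', 0 ≤ ρ y y') (hρ1 : ∀ y y', y ≠ y' → 1 ≤ ρ y y')
    (hμ : ∀ y, y ∉ T → μ y = 0) (hν : ∀ y, y ∉ T → ν y = 0)
    (huv : ∀ y y', μ y ≠ 0 → ν y' ≠ 0 → u y - v y' ≤ ρ y y')
    (ξ : V → V → ℝ) (h0 : ∀ y y', 0 ≤ ξ y y')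
    (hz1 : ∀ y y', y ∉ T → ξ y y' = 0) (hz2 : ∀ y y', y' ∉ T → ξ y y' = 0)
    (hr : ∀ y, ∑ y' ∈ T, ξ y y' = μ y) (hcol : ∀ y', ∑ y ∈ T, ξ y y' = ν y')
    (ht : ∀ y y', ξ y y' ≠ 0 → ρ y y' ≤ u y - v y') :
    W1 ρ μ ν = ∑ y ∈ T, u y * μ y - ∑ y ∈ T, v y * ν y := by
  obtain ⟨c, hc, hm⟩ := aux_upper T ρ μ ν u v ξ h0 hz1 hz2 hr hcol ht
  have hlow : ∀ c ∈ {c | ∃ ξ, IsCoupling μ ν ξ ∧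
      HasSum (fun p : V × V => ξ p.1 p.2 * ρ p.1 p.2) c},
      ∑ y ∈ T, u y * μ y - ∑ y ∈ T, v y * ν y ≤ c := by
    rintro c ⟨ξ, h1, h2⟩
    exact aux_lower T ρ μ ν u v hρ0 hρ1 hμ hν huv ξ h1 c h2
  unfold W1
  apply le_antisymm
  · exact (csInf_le ⟨_, hlow⟩ hm).trans hc
  · exact le_csInf ⟨c, hm⟩ hlow

lemma aux_arith0 {R : Type*} [CommRing R] (i j o w : R) (hw : w = o + o) (n1 : o ≠ 0)
    (n2 : o + o ≠ 0) (n3 : o + o + o ≠ 0) (n4 : o + o + o + o ≠ 0) :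
    i + o ≠ i - o ∧ i + w ≠ i - w ∧
    ((i ≠ j ∧ (i = j + o ∨ j = i + o)) → (j = i + o ∨ j = i - o)) ∧
    (i ≠ i + o ∧ (i = i + o + o ∨ i + o = i + o)) ∧
    (i ≠ i - o ∧ (i = i - o + o ∨ i - o = i + o)) ∧
    ¬ (i ≠ i + w ∧ (i = i + w + o ∨ i + w = i + o)) ∧
    ¬ (i ≠ i - w ∧ (i = i - w + o ∨ i - w = i + o)) ∧
    i + w ≠ i ∧ i - w ≠ i ∧
    (j ≠ i → ((i + o ≠ j ∧ (i + o = j + o ∨ j = i + o + o)) ↔ j = i + w)) ∧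
    (j ≠ i → ((i - o ≠ j ∧ (i - o = j + o ∨ j = i - o + o)) ↔ j = i - w)) := by
  subst hw
  refine ⟨?_, ?_, ?_, ?_, ?_, ?_, ?_, ?_, ?_, ?_, ?_⟩ <;> grind

lemma aux_arith {R : Type*} [CommRing R] (i j : R) (n1 : (1 : R) ≠ 0) (n2 : (2 : R) ≠ 0)
    (n3 : (3 : R) ≠ 0) (n4 : (4 : R) ≠ 0) :
    i + 1 ≠ i - 1 ∧ i + 2 ≠ i - 2 ∧
    ((i ≠ j ∧ (i = j + 1 ∨ j = i + 1)) → (j = i + 1 ∨ j = i - 1)) ∧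
    (i ≠ i + 1 ∧ (i = i + 1 + 1 ∨ i + 1 = i + 1)) ∧
    (i ≠ i - 1 ∧ (i = i - 1 + 1 ∨ i - 1 = i + 1)) ∧
    ¬ (i ≠ i + 2 ∧ (i = i + 2 + 1 ∨ i + 2 = i + 1)) ∧
    ¬ (i ≠ i - 2 ∧ (i = i - 2 + 1 ∨ i - 2 = i + 1)) ∧
    i + 2 ≠ i ∧ i - 2 ≠ i ∧
    (j ≠ i → ((i + 1 ≠ j ∧ (i + 1 = j + 1 ∨ j = i + 1 + 1)) ↔ j = i + 2)) ∧
    (j ≠ i → ((i - 1 ≠ j ∧ (i - 1 = j + 1 ∨ j = i - 1 + 1)) ↔ j = i - 2)) := by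
  apply aux_arith0 i j 1 2 (by norm_num) n1
  · intro h; apply n2; rw [← h]; norm_num
  · intro h; apply n3; rw [← h]; norm_num
  · intro h; apply n4; rw [← h]; norm_num

lemma aux_link {V : Type*} (G : SimpleGraph V) (v w : V) (hB : LinkIsCycle G v)
    (hn : 5 ≤ deg G v) (hw : G.Adj v w) :
    ∃ a b p q : V, a ≠ b ∧ p ≠ q ∧ (∀ z, (G.Adj v z ∧ G.Adj w z) ↔ (z = a ∨ z = b)) ∧
      (G.Adj v p ∧ ¬ G.Adj w p ∧ p ≠ w) ∧ (G.Adj v q ∧ ¬ G.Adj w q ∧ q ≠ w) ∧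
      (∀ z, G.Adj v z → ¬ G.Adj w z → z ≠ w → (G.Adj a z ↔ z = p)) ∧
      (∀ z, G.Adj v z → ¬ G.Adj w z → z ≠ w → (G.Adj b z ↔ z = q)) := by
  obtain ⟨e, he⟩ := hB
  generalize deg G v = n at *
  obtain ⟨i, hi⟩ := e.surjective ⟨w, hw⟩
  have hne : ∀ k : ℕ, 0 < k → k < 5 → (k : ZMod n) ≠ 0 := by
    intro k hk hk5 h
    rw [ZMod.natCast_eq_zero_iff] at h
    have := Nat.le_of_dvd hk h
    omega
  have n1 : (1 : ZMod n) ≠ 0 := by simpa using hne 1 (by norm_num) (by norm_num)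
  have n2 : (2 : ZMod n) ≠ 0 := by simpa using hne 2 (by norm_num) (by norm_num)
  have n3 : (3 : ZMod n) ≠ 0 := by simpa using hne 3 (by norm_num) (by norm_num)
  have n4 : (4 : ZMod n) ≠ 0 := by simpa using hne 4 (by norm_num) (by norm_num)
  have hwe : w = e i := by rw [hi]
  have inj : ∀ j k, ((e j : V) = e k ↔ j = k) := by
    intro j k; rw [← Subtype.ext_iff]; exact e.injective.eq_iff
  have sur : ∀ z, G.Adj v z → ∃ j, z = e j := by
    intro z hz
    obtain ⟨j, hj⟩ := e.surjective ⟨z, hz⟩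
    exact ⟨j, by rw [hj]⟩
  subst hwe
  refine ⟨e (i+1), e (i-1), e (i+2), e (i-2), ?_, ?_, ?_, ?_, ?_, ?_, ?_⟩
  · rw [Ne, inj]; exact (aux_arith i i n1 n2 n3 n4).1
  · rw [Ne, inj]; exact (aux_arith i i n1 n2 n3 n4).2.1
  · intro z
    constructor
    · rintro ⟨h1, h2⟩
      obtain ⟨j, rfl⟩ := sur z h1
      rw [he] at h2
      rw [inj, inj]; exact (aux_arith i j n1 n2 n3 n4).2.2.1 h2
    · rintro (rfl | rfl)
      · refine ⟨(e _).2, ?_⟩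
        rw [he]; exact (aux_arith i i n1 n2 n3 n4).2.2.2.1
      · refine ⟨(e _).2, ?_⟩
        rw [he]; exact (aux_arith i i n1 n2 n3 n4).2.2.2.2.1
  · refine ⟨(e _).2, ?_, ?_⟩
    · rw [he]; exact (aux_arith i i n1 n2 n3 n4).2.2.2.2.2.1
    · rw [Ne, inj]; exact (aux_arith i i n1 n2 n3 n4).2.2.2.2.2.2.2.1
  · refine ⟨(e _).2, ?_, ?_⟩
    · rw [he]; exact (aux_arith i i n1 n2 n3 n4).2.2.2.2.2.2.1
    · rw [Ne, inj]; exact (aux_arith i i n1 n2 n3 n4).2.2.2.2.2.2.2.2.1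
  · intro z hz h1 h2
    obtain ⟨j, rfl⟩ := sur z hz
    rw [Ne, inj] at h2
    rw [he, inj]; exact (aux_arith i j n1 n2 n3 n4).2.2.2.2.2.2.2.2.2.1 h2
  · intro z hz h1 h2
    obtain ⟨j, rfl⟩ := sur z hz
    rw [Ne, inj] at h2
    rw [he, inj]; exact (aux_arith i j n1 n2 n3 n4).2.2.2.2.2.2.2.2.2.2 h2

lemma aux_huv {V : Type*} (G : SimpleGraph V) (hconn : G.Connected) (x x' a b p' q' : V)
    (hadj : G.Adj x x')
    (hG : GeodesicsInStars G x x')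
    (hexcl : ∀ y y', G.Adj x y → G.Adj x' y' → ¬G.Adj x' y → ¬G.Adj x y' →
      y ≠ x' → y' ≠ x → ¬G.Adj y y')
    (hab : a ≠ b) (hcom : ∀ z, (G.Adj x z ∧ G.Adj x' z) ↔ (z = a ∨ z = b))
    (hpq : p' ≠ q')
    (hp : G.Adj x' p' ∧ ¬ G.Adj x p' ∧ p' ≠ x) (hq : G.Adj x' q' ∧ ¬ G.Adj x q' ∧ q' ≠ x)
    (hap : ∀ z, G.Adj x' z → ¬ G.Adj x z → z ≠ x → (G.Adj a z ↔ z = p'))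
    (hbq : ∀ z, G.Adj x' z → ¬ G.Adj x z → z ≠ x → (G.Adj b z ↔ z = q'))
    (u v : V → ℝ) (hux : u x = 1) (hux' : u x' = 0) (hua : u a = 1) (hub : u b = 1)
    (hu : ∀ y, G.Adj x y → ¬ G.Adj x' y → y ≠ x' → u y = 2)
    (hvx : v x = 1) (hvx' : v x' = 0) (hva : v a = 1) (hvb : v b = 1)
    (hvp : v p' = 0) (hvq : v q' = 0)
    (hv : ∀ y, G.Adj x' y → ¬ G.Adj x y → y ≠ x → y ≠ p' → y ≠ q' → v y = -1)
    (y y' : V) (hy : y = x ∨ G.Adj x y) (hy' : y' = x' ∨ G.Adj x' y') :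
    u y - v y' ≤ graphDist G y y' := by
  have D0 : ∀ y z, (0 : ℝ) ≤ graphDist G y z := fun y z => by unfold graphDist; positivity
  have D1 : ∀ y z, y ≠ z → (1 : ℝ) ≤ graphDist G y z := by
    intro y z h
    unfold graphDist
    exact_mod_cast hconn.pos_dist_of_ne h
  have D2 : ∀ y z, y ≠ z → ¬ G.Adj y z → (2 : ℝ) ≤ graphDist G y z := by
    intro y z h h2
    unfold graphDist
    have h3 := hconn.pos_dist_of_ne h
    have h4 : G.dist y z ≠ 1 := fun h => h2 (SimpleGraph.dist_eq_one_iff_adj.1 h)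
    exact_mod_cast (by omega : 2 ≤ G.dist y z)
  have ha := (hcom a).2 (Or.inl rfl)
  have hb := (hcom b).2 (Or.inr rfl)
  have D3 : ∀ y z, G.Adj x y → ¬ G.Adj x' y → y ≠ x' → G.Adj x' z → ¬ G.Adj x z → z ≠ x →
      z ≠ p' → z ≠ q' → (3 : ℝ) ≤ graphDist G y z := by
    intro y z h1 h2 h3 h4 h5 h6 h7 h8
    have hne : y ≠ z := by rintro rfl; exact h2 h4
    have hna := hexcl y z h1 h4 h2 h5 h3 h6
    have h9 := D2 y z hne hna
    unfold graphDist at h9 ⊢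
    have h10 : 2 ≤ G.dist y z := by exact_mod_cast h9
    have h11 : G.dist y z ≠ 2 := by
      intro h
      obtain ⟨w, hw, hws⟩ := hG y z (Or.inr h1) (Or.inr h4)
      rw [h] at hw
      cases w with
      | nil => simp at hw
      | @cons _ m _ hm w =>
        cases w with
        | nil => simp at hw
        | @cons _ m2 _ hm2 w =>
          cases w with
          | cons _ _ => simp at hw
          | nil =>
            have hms := hws m (by simp)
            have hxm : ¬ m = x := by rintro rfl; exact h5 hm2
            have hx'm : ¬ m = x' := by rintro rfl; exact h2 hm.symm
            have hmab : ¬ (m = a ∨ m = b) := by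
              rintro (rfl | rfl)
              · exact h7 ((hap z h4 h5 h6).1 hm2)
              · exact h8 ((hbq z h4 h5 h6).1 hm2)
            rw [← hcom] at hmab
            simp only [starSet, Set.mem_union, Set.mem_insert_iff, SimpleGraph.mem_neighborSet,
              hxm, hx'm, false_or] at hms
            rcases hms with hms | hms
            · exact hexcl m z hms h4 (fun h => hmab ⟨hms, h⟩) h5 hx'm h6 hm2
            · exact hexcl y m h1 hms h2 (fun h => hmab ⟨h, hms⟩) h3 hxm hm
    exact_mod_cast (by omega : 3 ≤ G.dist y z)
  -- classification
  have cy : y = x ∨ y = x' ∨ y = a ∨ y = b ∨ (G.Adj x y ∧ ¬ G.Adj x' y ∧ y ≠ x') := by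
    rcases hy with h | h
    · exact Or.inl h
    by_cases h2 : y = x'
    · exact Or.inr (Or.inl h2)
    by_cases h3 : G.Adj x' y
    · rcases (hcom y).1 ⟨h, h3⟩ with h4 | h4
      · exact Or.inr (Or.inr (Or.inl h4))
      · exact Or.inr (Or.inr (Or.inr (Or.inl h4)))
    · exact Or.inr (Or.inr (Or.inr (Or.inr ⟨h, h3, h2⟩)))
  have cy' : y' = x' ∨ y' = x ∨ y' = a ∨ y' = b ∨ y' = p' ∨ y' = q' ∨
      (G.Adj x' y' ∧ ¬ G.Adj x y' ∧ y' ≠ x ∧ y' ≠ p' ∧ y' ≠ q') := by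
    rcases hy' with h | h
    · exact Or.inl h
    by_cases h2 : y' = x
    · exact Or.inr (Or.inl h2)
    by_cases h3 : G.Adj x y'
    · rcases (hcom y').1 ⟨h3, h⟩ with h4 | h4
      · exact Or.inr (Or.inr (Or.inl h4))
      · exact Or.inr (Or.inr (Or.inr (Or.inl h4)))
    by_cases h4 : y' = p'
    · exact Or.inr (Or.inr (Or.inr (Or.inr (Or.inl h4))))
    by_cases h5 : y' = q'
    · exact Or.inr (Or.inr (Or.inr (Or.inr (Or.inr (Or.inl h5)))))
    exact Or.inr (Or.inr (Or.inr (Or.inr (Or.inr (Or.inr ⟨h, h3, h2, h4, h5⟩)))))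
  have near : ∀ y, (y = a ∨ y = b) → u y = 1 ∧ v y = 1 ∧ y ≠ x' ∧ y ≠ x := by
    rintro y (rfl | rfl)
    · exact ⟨hua, hva, ha.2.ne', ha.1.ne'⟩
    · exact ⟨hub, hvb, hb.2.ne', hb.1.ne'⟩
  have near' : ∀ y, (y = p' ∨ y = q') → v y = 0 ∧ G.Adj x' y ∧ ¬ G.Adj x y ∧ y ≠ x := by
    rintro y (rfl | rfl)
    · exact ⟨hvp, hp⟩
    · exact ⟨hvq, hq⟩
  rw [← or_assoc (a := y = a)] at cy
  rw [← or_assoc (a := y' = a), ← or_assoc (a := y' = p')] at cy'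
  have hyy := D0 y y'
  rcases cy' with rfl | rfl | h | h | ⟨h1, h2, h3, h4, h5⟩
  · rw [hvx']
    rcases cy with rfl | rfl | g | ⟨g1, g2, g3⟩
    · rw [hux]; linarith [D1 _ _ hadj.ne]
    · rw [hux']; linarith
    · obtain ⟨k1, k2, k3, k4⟩ := near _ g
      rw [k1]; linarith [D1 _ _ k3]
    · rw [hu _ g1 g2 g3]; linarith [D2 _ _ g3 (fun h => g2 h.symm)]
  · rw [hvx]
    rcases cy with rfl | rfl | g | ⟨g1, g2, g3⟩
    · rw [hux]; linarith
    · rw [hux']; linarith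
    · obtain ⟨k1, k2, k3, k4⟩ := near _ g
      rw [k1]; linarith
    · rw [hu _ g1 g2 g3]; linarith [D1 _ _ g1.ne']
  · rw [(near _ h).2.1]
    rcases cy with rfl | rfl | g | ⟨g1, g2, g3⟩
    · rw [hux]; linarith
    · rw [hux']; linarith
    · obtain ⟨k1, k2, k3, k4⟩ := near _ g
      rw [k1]; linarith
    · have : y ≠ y' := by
        rintro rfl
        exact g2 ((hcom y).2 h).2
      rw [hu _ g1 g2 g3]; linarith [D1 _ _ this]
  · obtain ⟨k0, k1, k2, k3⟩ := near' _ h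
    rw [k0]
    rcases cy with rfl | rfl | g | ⟨g1, g2, g3⟩
    · rw [hux]; linarith [D1 _ _ k3.symm]
    · rw [hux']; linarith
    · have : y ≠ y' := by
        rintro rfl
        exact k2 ((hcom y).2 g).1
      rw [(near _ g).1]; linarith [D1 _ _ this]
    · have : y ≠ y' := by
        rintro rfl
        exact g2 k1
      rw [hu _ g1 g2 g3]; linarith [D2 _ _ this (hexcl _ _ g1 k1 g2 k2 g3 k3)]
  · rw [hv _ h1 h2 h3 h4 h5]
    rcases cy with rfl | rfl | g | ⟨g1, g2, g3⟩
    · rw [hux]; linarith [D2 _ _ h3.symm h2]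
    · rw [hux']; linarith [D1 _ _ h1.ne]
    · have t1 : y ≠ y' := by
        rintro rfl
        exact h2 ((hcom y).2 g).1
      have t2 : ¬ G.Adj y y' := by
        rcases g with rfl | rfl
        · rw [hap _ h1 h2 h3]; exact h4
        · rw [hbq _ h1 h2 h3]; exact h5
      rw [(near _ g).1]; linarith [D2 _ _ t1 t2]
    · rw [hu _ g1 g2 g3]; linarith [D3 _ _ g1 g2 g3 h1 h2 h3 h4 h5]

set_option maxHeartbeats 2000000 in
lemma aux_main {V : Type*} (G : SimpleGraph V) (hconn : G.Connected) (x x' a b p q p' q' : V)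
    (hadj : G.Adj x x')
    (hG : GeodesicsInStars G x x')
    (hexcl : ∀ y y', G.Adj x y → G.Adj x' y' → ¬G.Adj x' y → ¬G.Adj x y' →
      y ≠ x' → y' ≠ x → ¬G.Adj y y')
    (hab : a ≠ b) (hcom : ∀ z, (G.Adj x z ∧ G.Adj x' z) ↔ (z = a ∨ z = b))
    (hpq0 : p ≠ q) (hp0 : G.Adj x p ∧ ¬ G.Adj x' p ∧ p ≠ x')
    (hq0 : G.Adj x q ∧ ¬ G.Adj x' q ∧ q ≠ x') (hap0 : G.Adj a p) (hbq0 : G.Adj b q)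
    (hpq : p' ≠ q')
    (hp : G.Adj x' p' ∧ ¬ G.Adj x p' ∧ p' ≠ x) (hq : G.Adj x' q' ∧ ¬ G.Adj x q' ∧ q' ≠ x)
    (hap : ∀ z, G.Adj x' z → ¬ G.Adj x z → z ≠ x → (G.Adj a z ↔ z = p'))
    (hbq : ∀ z, G.Adj x' z → ¬ G.Adj x z → z ≠ x → (G.Adj b z ↔ z = q'))
    (N N' : Finset V) (hN : ∀ z, z ∈ N ↔ G.Adj x z) (hN' : ∀ z, z ∈ N' ↔ G.Adj x' z)
    (t s s' : ℝ) (ht0 : 0 < t) (ht1 : t ≤ 1 / 2) (hs' : 0 ≤ s') (hss : s' ≤ s)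
    (hsN : s * N.card = t) (hsN' : s' * N'.card = t)
    (μ ν : V → ℝ) (hμ : ∀ y, μ y = (1 - t) * (if y = x then 1 else 0) + s * if y ∈ N then 1 else 0)
    (hν : ∀ y, ν y = (1 - t) * (if y = x' then 1 else 0) + s' * if y ∈ N' then 1 else 0) :
    W1 (graphDist G) μ ν = 1 + 2 * t - 4 * s - 8 * s' := by
  have ha := (hcom a).2 (Or.inl rfl)
  have hb := (hcom b).2 (Or.inr rfl)
  have hxx := hadj.ne
  have dax := ha.1.ne'
  have dbx := hb.1.ne'
  have dax' := ha.2.ne'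
  have dbx' := hb.2.ne'
  have dpx := hp0.1.ne'
  have dqx := hq0.1.ne'
  have dpx' := hp0.2.2
  have dqx' := hq0.2.2
  have dp'x' := hp.1.ne'
  have dq'x' := hq.1.ne'
  have dp'x := hp.2.2
  have dq'x := hq.2.2
  have dpa : p ≠ a := hap0.ne'
  have dqb : q ≠ b := hbq0.ne'
  have dpb : p ≠ b := by rintro rfl; exact hp0.2.1 hb.2
  have dqa : q ≠ a := by rintro rfl; exact hq0.2.1 ha.2
  have dp'a : p' ≠ a := by rintro rfl; exact hp.2.1 ha.1
  have dq'a : q' ≠ a := by rintro rfl; exact hq.2.1 ha.1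
  have dp'b : p' ≠ b := by rintro rfl; exact hp.2.1 hb.1
  have dq'b : q' ≠ b := by rintro rfl; exact hq.2.1 hb.1
  have mxN : x ∉ N := by simp [hN]
  have mx'N : x' ∈ N := (hN _).2 hadj
  have maN : a ∈ N := (hN _).2 ha.1
  have mbN : b ∈ N := (hN _).2 hb.1
  have mpN : p ∈ N := (hN _).2 hp0.1
  have mqN : q ∈ N := (hN _).2 hq0.1
  have mx'N' : x' ∉ N' := by simp [hN']
  have mxN' : x ∈ N' := (hN' _).2 hadj.symm
  have maN' : a ∈ N' := (hN' _).2 ha.2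
  have mbN' : b ∈ N' := (hN' _).2 hb.2
  have mpN' : p' ∈ N' := (hN' _).2 hp.1
  have mqN' : q' ∈ N' := (hN' _).2 hq.1
  set I : V → V → ℝ := fun z y => if y = z then 1 else 0 with hI
  set J : V → ℝ := fun y => if y ∈ N then 1 else 0 with hJ
  set J' : V → ℝ := fun y => if y ∈ N' then 1 else 0 with hJ'
  set u : V → ℝ := fun y => 2 - I x y - 2 * I x' y - I a y - I b y with hu
  set v : V → ℝ := fun y => -1 + I x' y + 2 * I x y + 2 * I a y + 2 * I b y + I p' y + I q' y with hv
  set g : V → ℝ := fun y => s * J y - s * I x' y - s' * (I a y + I b y + I p y + I q y) with hg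
  set h : V → ℝ := fun y => s' * J' y - s' * (I x y + I a y + I b y + I p' y + I q' y) with hh
  set R : ℝ := 1 - 2 * t + 4 * s' with hR
  set T : Finset V := N ∪ N' with hT
  set ξ : V → V → ℝ := fun y y' => s' * (I x y * I x y') + s * (I x' y * I x' y')
    + s' * (I a y * I a y') + s' * (I b y * I b y') + s' * (I p y * I p' y')
    + s' * (I q y * I q' y') + g y * I x' y' + I x y * h y' + R * (I x y * I x' y') with hξ
  have I0 : ∀ z y, 0 ≤ I z y := by intro z y; simp only [hI]; split_ifs <;> norm_num
  have g0 : ∀ y, 0 ≤ g y := by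
    intro y
    by_cases h1 : y = x'
    · subst h1; simp [hg, hI, hJ, mx'N, Ne.symm dax', Ne.symm dbx', Ne.symm dpx', Ne.symm dqx']
    by_cases h2 : y = a
    · subst h2; simp [hg, hI, hJ, h1, maN, hab, hss, Ne.symm dpa, Ne.symm dqa]
    by_cases h3 : y = b
    · subst h3; simp [hg, hI, hJ, h1, h2, mbN, hss, Ne.symm dpb, Ne.symm dqb, Ne.symm hab]
    by_cases h4 : y = p
    · subst h4; simp [hg, hI, hJ, h1, h2, h3, mpN, hpq0, hss]
    by_cases h5 : y = q
    · subst h5; simp [hg, hI, hJ, h1, h2, h3, h4, mqN, hss]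
    simp only [hg, hI, hJ, h1, h2, h3, h4, h5, if_false]
    split_ifs <;> linarith
  have h0 : ∀ y, 0 ≤ h y := by
    intro y
    by_cases h1 : y = x
    · subst h1; simp [hh, hI, hJ', mxN', Ne.symm dax, Ne.symm dbx, Ne.symm dp'x, Ne.symm dq'x]
    by_cases h2 : y = a
    · subst h2; simp [hh, hI, hJ', h1, maN', hab, Ne.symm dp'a, Ne.symm dq'a]
    by_cases h3 : y = b
    · subst h3; simp [hh, hI, hJ', h1, h2, mbN', Ne.symm dp'b, Ne.symm dq'b]
    by_cases h4 : y = p'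
    · subst h4; simp [hh, hI, hJ', h1, h2, h3, mpN', hpq]
    by_cases h5 : y = q'
    · subst h5; simp [hh, hI, hJ', h1, h2, h3, h4, mqN']
    simp only [hh, hI, hJ', h1, h2, h3, h4, h5, if_false]
    split_ifs <;> linarith
  have R0 : 0 ≤ R := by simp only [hR]; linarith
  have s0 : 0 ≤ s := hs'.trans hss
  have sI : ∀ z ∈ T, ∑ y ∈ T, I z y = 1 := by
    intro z hz; simp only [hI]; rw [Finset.sum_ite_eq' T z]; simp [hz]
  have sJ : ∑ y ∈ T, J y = N.card := by
    simp only [hJ, Finset.sum_boole]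
    congr 2
    ext z; simp only [Finset.mem_filter, hT, Finset.mem_union]; tauto
  have sJ' : ∑ y ∈ T, J' y = N'.card := by
    simp only [hJ', Finset.sum_boole]
    congr 2
    ext z; simp only [Finset.mem_filter, hT, Finset.mem_union]; tauto
  have Tx : x ∈ T := Finset.mem_union_right _ mxN'
  have Tx' : x' ∈ T := Finset.mem_union_left _ mx'N
  have Ta : a ∈ T := Finset.mem_union_left _ maN
  have Tb : b ∈ T := Finset.mem_union_left _ mbN
  have Tp : p ∈ T := Finset.mem_union_left _ mpN
  have Tq : q ∈ T := Finset.mem_union_left _ mqN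
  have Tp' : p' ∈ T := Finset.mem_union_right _ mpN'
  have Tq' : q' ∈ T := Finset.mem_union_right _ mqN'
  have Iz : ∀ z ∈ T, ∀ y, y ∉ T → I z y = 0 := by
    intro z hz y hy
    have : y ≠ z := by rintro rfl; exact hy hz
    simp [hI, this]
  have Jz : ∀ y, y ∉ T → J y = 0 := by
    intro y hy
    have : y ∉ N := fun h => hy (Finset.mem_union_left _ h)
    simp [hJ, this]
  have J'z : ∀ y, y ∉ T → J' y = 0 := by
    intro y hy
    have : y ∉ N' := fun h => hy (Finset.mem_union_right _ h)
    simp [hJ', this]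
  have hμ2 : ∀ y, μ y = (1 - t) * I x y + s * J y := hμ
  have hν2 : ∀ y, ν y = (1 - t) * I x' y + s' * J' y := hν
  have sg : ∑ y ∈ T, g y = t - s - 4 * s' := by
    simp only [hg, Finset.sum_sub_distrib, Finset.sum_add_distrib, ← Finset.mul_sum, sJ,
      sI _ Tx', sI _ Ta, sI _ Tb, sI _ Tp, sI _ Tq]
    linarith
  have sh : ∑ y ∈ T, h y = t - 5 * s' := by
    simp only [hh, Finset.sum_sub_distrib, Finset.sum_add_distrib, ← Finset.mul_sum, sJ',
      sI _ Tx, sI _ Ta, sI _ Tb, sI _ Tp', sI _ Tq']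
    linarith
  have ux : u x = 1 := by
    simp [hu, hI, hxx, Ne.symm dax, Ne.symm dbx]; norm_num
  have ux' : u x' = 0 := by
    simp [hu, hI, hxx.symm, Ne.symm dax', Ne.symm dbx']
  have ua : u a = 1 := by
    simp [hu, hI, dax, dax', hab]; norm_num
  have ub : u b = 1 := by
    simp [hu, hI, dbx, dbx', hab.symm]; norm_num
  have uo : ∀ y, G.Adj x y → ¬ G.Adj x' y → y ≠ x' → u y = 2 := by
    intro y h1 h2 h3
    have e1 : y ≠ a := by rintro rfl; exact h2 ha.2
    have e2 : y ≠ b := by rintro rfl; exact h2 hb.2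
    simp [hu, hI, e1, e2, h3, h1.ne']
  have vx : v x = 1 := by
    simp [hv, hI, hxx, Ne.symm dax, Ne.symm dbx, Ne.symm dp'x, Ne.symm dq'x]; norm_num
  have vx' : v x' = 0 := by
    simp [hv, hI, hxx.symm, Ne.symm dax', Ne.symm dbx', Ne.symm dp'x', Ne.symm dq'x']
  have va : v a = 1 := by
    simp [hv, hI, dax, dax', hab, Ne.symm dp'a, Ne.symm dq'a]; norm_num
  have vb : v b = 1 := by
    simp [hv, hI, dbx, dbx', hab.symm, Ne.symm dp'b, Ne.symm dq'b]; norm_num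
  have vp : v p' = 0 := by
    simp [hv, hI, dp'x, dp'x', dp'a, dp'b, hpq]
  have vq : v q' = 0 := by
    simp [hv, hI, dq'x, dq'x', dq'a, dq'b, hpq.symm]
  have vo : ∀ y, G.Adj x' y → ¬ G.Adj x y → y ≠ x → y ≠ p' → y ≠ q' → v y = -1 := by
    intro y h1 h2 h3 h4 h5
    have e1 : y ≠ a := by rintro rfl; exact h2 ha.1
    have e2 : y ≠ b := by rintro rfl; exact h2 hb.1
    simp [hv, hI, e1, e2, h3, h4, h5, h1.ne']
  have W := aux_W1 T (graphDist G) μ ν u v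
    (fun y z => by unfold graphDist; positivity)
    (fun y z hyz => by unfold graphDist; exact_mod_cast hconn.pos_dist_of_ne hyz)
    (fun y hy => by rw [hμ2, Iz x Tx y hy, Jz y hy]; ring)
    (fun y hy => by rw [hν2, Iz x' Tx' y hy, J'z y hy]; ring)
    ?_ ξ ?_ ?_ ?_ ?_ ?_ ?_
  · rw [W]
    have e1 : ∑ y ∈ T, u y * μ y = (1 - t) + 2 * t - 4 * s := by
      have : ∀ y, u y * μ y = (1 - t) * I x y + s * (2 * J y - 2 * I x' y - I a y - I b y) := by
        intro y
        rw [hμ2]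
        by_cases h1 : y = x
        · subst h1; rw [ux]; simp [hI, hJ, mxN, hxx, Ne.symm dax, Ne.symm dbx]
        · by_cases h2 : y ∈ N
          · simp only [hu, hI, hJ, h1, h2, if_true, if_false]; ring
          · have k1 : y ≠ x' := by rintro rfl; exact h2 mx'N
            have k2 : y ≠ a := by rintro rfl; exact h2 maN
            have k3 : y ≠ b := by rintro rfl; exact h2 mbN
            simp [hI, hJ, h1, h2, k1, k2, k3]
      simp only [this, Finset.sum_sub_distrib, Finset.sum_add_distrib, ← Finset.mul_sum, sJ,
        sI _ Tx, sI _ Tx', sI _ Ta, sI _ Tb]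
      linarith
    have e2 : ∑ y ∈ T, v y * ν y = - t + 8 * s' := by
      have : ∀ y, v y * ν y =
          s' * (2 * I x y + 2 * I a y + 2 * I b y + I p' y + I q' y - J' y) := by
        intro y
        rw [hν2]
        by_cases h1 : y = x'
        · subst h1; rw [vx']
          simp [hI, hJ', mx'N', hxx.symm, Ne.symm dax', Ne.symm dbx', Ne.symm dp'x', Ne.symm dq'x']
        · by_cases h2 : y ∈ N'
          · simp only [hv, hI, hJ', h1, h2, if_true, if_false]; ring
          · have k1 : y ≠ x := by rintro rfl; exact h2 mxN'
            have k2 : y ≠ a := by rintro rfl; exact h2 maN'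
            have k3 : y ≠ b := by rintro rfl; exact h2 mbN'
            have k4 : y ≠ p' := by rintro rfl; exact h2 mpN'
            have k5 : y ≠ q' := by rintro rfl; exact h2 mqN'
            simp [hI, hJ', h1, h2, k1, k2, k3, k4, k5]
      simp only [this, Finset.sum_sub_distrib, Finset.sum_add_distrib, ← Finset.mul_sum, sJ',
        sI _ Tx, sI _ Tp', sI _ Tq', sI _ Ta, sI _ Tb]
      linarith
    rw [e1, e2]; ring
  · intro y y' h1 h2
    refine aux_huv G hconn x x' a b p' q' hadj hG hexcl hab hcom hpq hp hq hap hbq u v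
      ux ux' ua ub uo vx vx' va vb vp vq vo y y' ?_ ?_
    · by_contra hc
      push Not at hc
      apply h1; rw [hμ2]; simp [hI, hJ, hN, hc]
    · by_contra hc
      push Not at hc
      apply h2; rw [hν2]; simp [hI, hJ', hN', hc]
  · intro y y'
    simp only [hξ]
    have m : ∀ c z w, 0 ≤ c → 0 ≤ c * (I z y * I w y') := fun c z w hc =>
      mul_nonneg hc (mul_nonneg (I0 _ _) (I0 _ _))
    have := mul_nonneg (g0 y) (I0 x' y')
    have := mul_nonneg (I0 x y) (h0 y')
    linarith [m s' x x hs', m s x' x' s0, m s' a a hs', m s' b b hs', m s' p p' hs',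
      m s' q q' hs', m R x x' R0]
  · intro y y' hy
    simp only [hξ, hg, Jz y hy, Iz x Tx y hy, Iz x' Tx' y hy, Iz a Ta y hy, Iz b Tb y hy,
      Iz p Tp y hy, Iz q Tq y hy]
    ring
  · intro y y' hy
    simp only [hξ, hh, J'z y' hy, Iz x Tx y' hy, Iz x' Tx' y' hy, Iz a Ta y' hy, Iz b Tb y' hy,
      Iz p' Tp' y' hy, Iz q' Tq' y' hy]
    ring
  · intro y
    simp only [hξ, Finset.sum_add_distrib, ← Finset.mul_sum, sI _ Tx, sI _ Tx', sI _ Ta, sI _ Tb,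
      sI _ Tp', sI _ Tq', sh, hμ2, hg, hR]
    ring
  · intro y
    simp only [hξ, Finset.sum_add_distrib, ← Finset.mul_sum, ← Finset.sum_mul, sI _ Tx, sI _ Tx',
      sI _ Ta, sI _ Tb, sI _ Tp, sI _ Tq, sg, hν2, hh, hR]
    ring
  · intro y y' hne
    have dadj : ∀ y z, G.Adj y z → graphDist G y z ≤ 1 := by
      intro y z hyz; unfold graphDist; rw [SimpleGraph.dist_eq_one_iff_adj.2 hyz]; simp
    have d2 : ∀ y w z, G.Adj y w → G.Adj w z → graphDist G y z ≤ 2 := by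
      intro y w z h1 h2
      have := dadj _ _ h1
      have := dadj _ _ h2
      have h3 : graphDist G y z ≤ graphDist G y w + graphDist G w z := by
        unfold graphDist; exact_mod_cast hconn.dist_triangle
      linarith
    have dself : ∀ y, graphDist G y y = 0 := by intro y; simp [graphDist]
    have Ine : ∀ z y, I z y ≠ 0 → y = z := by
      intro z y h; by_contra h2; exact h (by simp [hI, h2])
    have pr : ∀ c z w, c * (I z y * I w y') ≠ 0 → y = z ∧ y' = w := by
      intro c z w h
      exact ⟨Ine _ _ (left_ne_zero_of_mul (right_ne_zero_of_mul h)),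
        Ine _ _ (right_ne_zero_of_mul (right_ne_zero_of_mul h))⟩
    by_cases c1 : s' * (I x y * I x y') = 0
    swap
    · obtain ⟨rfl, rfl⟩ := pr _ _ _ c1; rw [dself, ux, vx]; norm_num
    by_cases c2 : s * (I x' y * I x' y') = 0
    swap
    · obtain ⟨rfl, rfl⟩ := pr _ _ _ c2; rw [dself, ux', vx']; norm_num
    by_cases c3 : s' * (I a y * I a y') = 0
    swap
    · obtain ⟨rfl, rfl⟩ := pr _ _ _ c3; rw [dself, ua, va]; norm_num
    by_cases c4 : s' * (I b y * I b y') = 0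
    swap
    · obtain ⟨rfl, rfl⟩ := pr _ _ _ c4; rw [dself, ub, vb]; norm_num
    by_cases c5 : s' * (I p y * I p' y') = 0
    swap
    · obtain ⟨rfl, rfl⟩ := pr _ _ _ c5
      rw [uo _ hp0.1 hp0.2.1 hp0.2.2, vp]
      have := d2 y a y' hap0.symm ((hap y' hp.1 hp.2.1 hp.2.2).2 rfl)
      linarith
    by_cases c6 : s' * (I q y * I q' y') = 0
    swap
    · obtain ⟨rfl, rfl⟩ := pr _ _ _ c6
      rw [uo _ hq0.1 hq0.2.1 hq0.2.2, vq]
      have := d2 y b y' hbq0.symm ((hbq y' hq.1 hq.2.1 hq.2.2).2 rfl)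
      linarith
    by_cases c7 : R * (I x y * I x' y') = 0
    swap
    · obtain ⟨rfl, rfl⟩ := pr _ _ _ c7
      rw [ux, vx']
      linarith [dadj _ _ hadj]
    by_cases c8 : g y * I x' y' = 0
    swap
    · obtain rfl := Ine _ _ (right_ne_zero_of_mul c8)
      have hgy := left_ne_zero_of_mul c8
      rw [vx']
      have hyx' : y ≠ y' := by
        rintro rfl; apply hgy
        simp [hg, hI, hJ, mx'N, Ne.symm dax', Ne.symm dbx', Ne.symm dpx', Ne.symm dqx']
      by_cases e1 : y = a
      · subst e1; rw [ua]; linarith [dadj _ _ ha.2.symm]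
      by_cases e2 : y = b
      · subst e2; rw [ub]; linarith [dadj _ _ hb.2.symm]
      have hyN : G.Adj x y := by
        rw [← hN]; by_contra hc; apply hgy
        have k1 : y ≠ p := by rintro rfl; exact hc mpN
        have k2 : y ≠ q := by rintro rfl; exact hc mqN
        simp [hg, hI, hJ, hc, e1, e2, k1, k2, hyx']
      have hyN' : ¬ G.Adj y' y := fun hc => by
        exact ((hcom y).1 ⟨hyN, hc⟩).elim e1 e2
      rw [uo _ hyN hyN' hyx']
      linarith [d2 _ _ _ hyN.symm hadj]
    by_cases c9 : I x y * h y' = 0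
    swap
    · obtain rfl := Ine _ _ (left_ne_zero_of_mul c9)
      have hhy := right_ne_zero_of_mul c9
      rw [ux]
      have e1 : y' ≠ y := by
        rintro rfl; apply hhy
        simp [hh, hI, hJ', mxN', Ne.symm dax, Ne.symm dbx, Ne.symm dp'x, Ne.symm dq'x]
      have e2 : y' ≠ a := by
        rintro rfl; apply hhy
        simp [hh, hI, hJ', e1, maN', hab, Ne.symm dp'a, Ne.symm dq'a]
      have e3 : y' ≠ b := by
        rintro rfl; apply hhy
        simp [hh, hI, hJ', e1, e2, mbN', Ne.symm dp'b, Ne.symm dq'b]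
      have e4 : y' ≠ p' := by
        rintro rfl; apply hhy
        simp [hh, hI, hJ', e1, e2, e3, mpN', hpq]
      have e5 : y' ≠ q' := by
        rintro rfl; apply hhy
        simp [hh, hI, hJ', e1, e2, e3, e4, mqN']
      have e6 : G.Adj x' y' := by
        rw [← hN']; by_contra hc; apply hhy
        simp [hh, hI, hJ', e1, e2, e3, e4, e5, hc]
      have e7 : ¬ G.Adj y y' := fun hc => by
        exact ((hcom y').1 ⟨hc, e6⟩).elim e2 e3
      rw [vo _ e6 e7 e1 e4 e5]
      linarith [d2 _ _ _ hadj e6]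
    exfalso
    apply hne
    simp only [hξ]
    rw [c1, c2, c3, c4, c5, c6, c7, c8, c9]
    ring

/-- on a triangulated surface, for an edge `(x,x')` with interior
endpoints of degrees `5 ≤ d ≤ d'`, `6 ≤ d'`, satisfying the genericity
hypotheses (B) and (G) (and with no spurious edges between exclusive neighbors
of `x` and of `x'`), the Ollivier–Ricci curvature is `4/d + 8/d' − 2`. -/
theorem generic_triangulated_surface_ric {V : Type*} (G : SimpleGraph V)
    (hconn : G.Connected) (hfin : ∀ v, (G.neighborSet v).Finite)
    (x x' : V) (hadj : G.Adj x x') (d d' : ℕ)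
    (hd : deg G x = d) (hd' : deg G x' = d')
    (hd5 : 5 ≤ d) (hdd' : d ≤ d') (hd6 : 6 ≤ d')
    (hBx : LinkIsCycle G x) (hBx' : LinkIsCycle G x')
    (hG : GeodesicsInStars G x x')
    (hexcl : ∀ y y', G.Adj x y → G.Adj x' y' → ¬G.Adj x' y → ¬G.Adj x y' →
      y ≠ x' → y' ≠ x → ¬G.Adj y y') :
    Filter.Tendsto (fun t => kappa G t x x' / t) (nhdsWithin 0 (Set.Ioi 0))
      (nhds (4 / (d : ℝ) + 8 / (d' : ℝ) - 2)) := by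
  have hd0 : (0 : ℝ) < d := by exact_mod_cast (by omega : 0 < d)
  have hd0' : (0 : ℝ) < d' := by exact_mod_cast (by omega : 0 < d')
  obtain ⟨a', b', p', q', hab', hpq, hcom', hp, hq, hap, hbq⟩ :=
    aux_link G x' x hBx' (by omega) hadj.symm
  have hP : ∃ p q, p ≠ q ∧ (G.Adj x p ∧ ¬ G.Adj x' p ∧ p ≠ x') ∧
      (G.Adj x q ∧ ¬ G.Adj x' q ∧ q ≠ x') ∧ G.Adj a' p ∧ G.Adj b' q := by
    obtain ⟨a, b, p, q, hab, hpq, hcom, hp, hq, hap, hbq⟩ := aux_link G x x' hBx (by omega) hadj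
    have ha : a = a' ∨ a = b' := (hcom' a).1 ((hcom a).2 (Or.inl rfl)).symm
    have hb : b = a' ∨ b = b' := (hcom' b).1 ((hcom b).2 (Or.inr rfl)).symm
    have h1 := (hap p hp.1 hp.2.1 hp.2.2).2 rfl
    have h2 := (hbq q hq.1 hq.2.1 hq.2.2).2 rfl
    rcases ha with rfl | rfl
    · rcases hb with rfl | rfl
      · exact absurd rfl hab
      · exact ⟨p, q, hpq, hp, hq, h1, h2⟩
    · rcases hb with rfl | rfl
      · exact ⟨q, p, hpq.symm, hq, hp, h2, h1⟩
      · exact absurd rfl hab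
  obtain ⟨p, q, hpq0, hp0, hq0, hap0, hbq0⟩ := hP
  have hcom : ∀ z, (G.Adj x z ∧ G.Adj x' z) ↔ (z = a' ∨ z = b') := by
    intro z; rw [← hcom', and_comm]
  have hcard : ∀ w, ((hfin w).toFinset.card : ℕ) = deg G w := by
    intro w
    rw [← Set.ncard_eq_toFinset_card _ (hfin w)]
    rfl
  have key : ∀ t : ℝ, 0 < t → t ≤ 1 / 2 →
      kappa G t x x' / t = 4 / (d : ℝ) + 8 / (d' : ℝ) - 2 := by
    intro t ht0 ht1
    have hW := aux_main G hconn x x' a' b' p q p' q' hadj hG hexcl hab' hcom hpq0 hp0 hq0 hap0 hbq0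
      hpq hp hq hap hbq (hfin x).toFinset (hfin x').toFinset (by simp) (by simp)
      t (t / d) (t / d') ht0 ht1 (by positivity)
      (div_le_div_of_nonneg_left ht0.le hd0 (by exact_mod_cast hdd'))
      (by rw [hcard, hd]; field_simp) (by rw [hcard, hd']; field_simp)
      (lazyWalk G t x) (lazyWalk G t x')
      (by
        intro y
        unfold lazyWalk
        by_cases h : y = x
        · subst h; simp
        · simp [h, hd])
      (by
        intro y
        unfold lazyWalk
        by_cases h : y = x'
        · subst h; simp
        · simp [h, hd'])
    have h1 : graphDist G x x' = 1 := by
      unfold graphDist; rw [SimpleGraph.dist_eq_one_iff_adj.2 hadj]; simp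
    unfold kappa
    rw [hW, h1]
    field_simp
    ring
  refine Tendsto.congr' ?_ tendsto_const_nhds
  have hmem : Set.Ioc (0 : ℝ) (1 / 2) ∈ nhdsWithin (0 : ℝ) (Set.Ioi 0) :=
    Ioc_mem_nhdsGT (by norm_num)
  filter_upwards [hmem] with t ht
  exact (key t ht.1 ht.2).symm
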